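/- If a profile of college choice functions Ch is DA-equivalent to a profile Ch' under which contracts are substitutes for every college and every college's choice function satisfies the law of aggregate demand, then the deferred acceptance mechanism for Ch is group-strategy-proof. -/

import Mathlib

open scoped Classical

namespace MWC

variable {C S T : Type*} [DecidableEq C] [DecidableEq S] [DecidableEq T] [LinearOrder T]

/-! Contracts are triples `(college, student, term)`.  For `x : C × S × T`,
`x.1` is the college, `x.2.1` the student and `x.2.2` the contract term.
The linear order on `T` plays the role of `▷`: higher terms are better for students. -/

variable (X : Finset (C × S × T))

/-- The contracts in `X` naming college `c` (the set `X_c`). -/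
def Xc (c : C) : Finset (C × S × T) := X.filter fun x => x.1 = c

/-- A set of contracts containing at most one contract per student. -/
def IsAlloc (Y : Finset (C × S × T)) : Prop :=
  ∀ x ∈ Y, ∀ y ∈ Y, x.2.1 = y.2.1 → x = y

/-- `Ch` is a valid choice function for college `c`: from each subset of `X_c` it
chooses a subset with at most one contract per student, and it satisfies the
irrelevance of rejected contracts (IRC). -/
def IsChoice (c : C) (Ch : Finset (C × S × T) → Finset (C × S × T)) : Prop :=
  (∀ Y, Y ⊆ Xc X c → Ch Y ⊆ Y) ∧
  (∀ Y, Y ⊆ Xc X c → IsAlloc (Ch Y)) ∧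
  (∀ Y, Y ⊆ Xc X c → ∀ x ∈ Xc X c, x ∉ Y → x ∉ Ch (insert x Y) → Ch Y = Ch (insert x Y))

/-- The rejection function `R_c(Y) = Y \ Ch_c(Y)`. -/
def Rej (Ch : Finset (C × S × T) → Finset (C × S × T)) (Y : Finset (C × S × T)) :
    Finset (C × S × T) := Y \ Ch Y

/-- Contracts are substitutes under `Ch` (for college `c`). -/
def Substitutes (c : C) (Ch : Finset (C × S × T) → Finset (C × S × T)) : Prop :=
  ∀ Y, Y ⊆ Xc X c → ∀ x ∈ Xc X c, ∀ z ∈ Xc X c, x ∉ Y → z ∉ Y →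
    x ∈ Ch (insert z (insert x Y)) → x ∈ Ch (insert x Y)

/-- The law of aggregate demand for `Ch` (college `c`). -/
def LAD (c : C) (Ch : Finset (C × S × T) → Finset (C × S × T)) : Prop :=
  ∀ Z Y, Z ⊆ Y → Y ⊆ Xc X c → (Ch Z).card ≤ (Ch Y).card

/-- `Y^min`: the contracts of `Y` that give each involved student his
`▷`-worst contract among his contracts in `Y`. -/
def Ymin (Y : Finset (C × S × T)) : Finset (C × S × T) :=
  Y.filter fun y => ∀ y' ∈ Y, y'.2.1 = y.2.1 → ¬ y'.2.2 < y.2.2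

/-- `Ch` is monotone in contract terms: it always chooses from `Y^min`. -/
def MonotoneCh (c : C) (Ch : Finset (C × S × T) → Finset (C × S × T)) : Prop :=
  ∀ Y, Y ⊆ Xc X c → Ch Y ⊆ Ymin Y

/-- `us` represents a strict preference of student `s` over his contracts in `X`
together with the outside option (utility `0`), monotone in contract terms:
a higher contract term is always strictly better. -/
def IsPref (s : S) (us : C × S × T → ℤ) : Prop :=
  (∀ x ∈ X, x.2.1 = s → us x ≠ 0) ∧
  (∀ x ∈ X, ∀ y ∈ X, x.2.1 = s → y.2.1 = s → x ≠ y → us x ≠ us y) ∧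
  (∀ x ∈ X, ∀ y ∈ X, x.2.1 = s → y.2.1 = s → y.2.2 < x.2.2 → us y < us x)

/-- The utility student `s` derives from allocation `Y` (`0` = outside option). -/
def util (us : C × S × T → ℤ) (s : S) (Y : Finset (C × S × T)) : ℤ :=
  ∑ x ∈ Y.filter (fun x => x.2.1 = s), us x

/-- Individual rationality of allocation `Y` in the market `(Ch, u)`. -/
def IndivRat (Ch : C → Finset (C × S × T) → Finset (C × S × T))
    (u : S → C × S × T → ℤ) (Y : Finset (C × S × T)) : Prop :=
  (∀ c, Y.filter (fun x => x.1 = c) = Ch c (Y.filter fun x => x.1 = c)) ∧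
  ∀ y ∈ Y, 0 < u y.2.1 y

/-- College `c` together with allocation `Z` blocks allocation `Y`. -/
def Blocks (Ch : C → Finset (C × S × T) → Finset (C × S × T))
    (u : S → C × S × T → ℤ) (c : C) (Z Y : Finset (C × S × T)) : Prop :=
  Z ⊆ X ∧ IsAlloc Z ∧
  Z.filter (fun x => x.1 = c) ≠ Y.filter (fun x => x.1 = c) ∧
  Z.filter (fun x => x.1 = c) = Ch c ((Y ∪ Z).filter fun x => x.1 = c) ∧
  ∀ z ∈ Z.filter (fun x => x.1 = c), util (u z.2.1) z.2.1 Y ≤ u z.2.1 z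

/-- Stability of allocation `Y` in the market `(Ch, u)`. -/
def Stable (Ch : C → Finset (C × S × T) → Finset (C × S × T))
    (u : S → C × S × T → ℤ) (Y : Finset (C × S × T)) : Prop :=
  Y ⊆ X ∧ IsAlloc Y ∧ IndivRat Ch u Y ∧ ¬ ∃ c Z, Blocks X Ch u c Z Y

/-- The contracts proposed when `D` is the set of contracts rejected so far:
every student proposes his most preferred acceptable not-yet-rejected contract. -/
def proposals (u : S → C × S × T → ℤ) (D : Finset (C × S × T)) : Finset (C × S × T) :=
  (X \ D).filter fun x =>
    0 < u x.2.1 x ∧ ∀ y ∈ X \ D, y.2.1 = x.2.1 → u x.2.1 y ≤ u x.2.1 x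

/-- The contracts tentatively held by the colleges among the proposals `P`:
each college `c` keeps its choice from the contracts proposed to it. -/
def held (Ch : C → Finset (C × S × T) → Finset (C × S × T))
    (P : Finset (C × S × T)) : Finset (C × S × T) :=
  P.filter fun x => x ∈ Ch x.1 (P.filter fun y => y.1 = x.1)

/-- One round of the student-proposing deferred acceptance algorithm, acting on the
cumulative set of rejected contracts. -/
def step (Ch : C → Finset (C × S × T) → Finset (C × S × T))
    (u : S → C × S × T → ℤ) (D : Finset (C × S × T)) : Finset (C × S × T) :=
  D ∪ (proposals X u D \ held Ch (proposals X u D))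

/-- The outcome `DA(Ch, u)` of the student-proposing deferred acceptance algorithm
(the algorithm reaches a fixed point after at most `|X| + 1` rounds). -/
def DA (Ch : C → Finset (C × S × T) → Finset (C × S × T))
    (u : S → C × S × T → ℤ) : Finset (C × S × T) :=
  held Ch (proposals X u ((step X Ch u)^[X.card + 1] ∅))

/-- The cumulative set of contracts proposed up to round `t` of the deferred
acceptance algorithm. -/
def cumProposed (Ch : C → Finset (C × S × T) → Finset (C × S × T))
    (u : S → C × S × T → ℤ) (t : ℕ) : Finset (C × S × T) :=
  (Finset.range (t + 1)).biUnion fun r => proposals X u ((step X Ch u)^[r] ∅)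

/-- Two choice profiles are deferred-acceptance-equivalent if the DA algorithm
produces the same outcome under both, for every profile of strict preferences
monotone in contract terms. -/
def DAeq (Ch Ch' : C → Finset (C × S × T) → Finset (C × S × T)) : Prop :=
  ∀ u : S → C × S × T → ℤ, (∀ s, IsPref X s (u s)) → DA X Ch u = DA X Ch' u

/-- `Ch` is DA-stable: the DA outcome is stable for every profile of strict
preferences monotone in contract terms. -/
def DAStable (Ch : C → Finset (C × S × T) → Finset (C × S × T)) : Prop :=
  ∀ u : S → C × S × T → ℤ, (∀ s, IsPref X s (u s)) → Stable X Ch u (DA X Ch u)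

/-- Mechanism `M` is `Ch`-stable. -/
def StableMech (Ch : C → Finset (C × S × T) → Finset (C × S × T))
    (M : (S → C × S × T → ℤ) → Finset (C × S × T)) : Prop :=
  ∀ u : S → C × S × T → ℤ, (∀ s, IsPref X s (u s)) → Stable X Ch u (M u)

/-- Strategy-proofness of a mechanism on the domain of strict preferences
monotone in contract terms. -/
def SP (M : (S → C × S × T → ℤ) → Finset (C × S × T)) : Prop :=
  ∀ u u' : S → C × S × T → ℤ, (∀ s, IsPref X s (u s)) → (∀ s, IsPref X s (u' s)) →
    ∀ s : S, (∀ s', s' ≠ s → u' s' = u s') →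
      util (u s) s (M u') ≤ util (u s) s (M u)

/-- Group-strategy-proofness of a mechanism on the domain of strict preferences
monotone in contract terms. -/
def GSP (M : (S → C × S × T → ℤ) → Finset (C × S × T)) : Prop :=
  ∀ u u' : S → C × S × T → ℤ, (∀ s, IsPref X s (u s)) → (∀ s, IsPref X s (u' s)) →
    ∀ S' : Set S, S'.Nonempty → (∀ s, s ∉ S' → u' s = u s) →
      ∃ s' ∈ S', util (u s') s' (M u') ≤ util (u s') s' (M u)

/-- The sequence `L` consists of contracts in `X_c`. -/
def SeqIn (c : C) (L : List (C × S × T)) : Prop := ∀ x ∈ L, x ∈ Xc X c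

/-- The sequence `L` is generated from monotone preferences: every contract (of the
relevant college) with the same student and a strictly higher term than the `t`-th
element appears among the first `t` elements. -/
def GenMono (c : C) (L : List (C × S × T)) : Prop :=
  ∀ (t : ℕ) (ht : t < L.length), ∀ x ∈ Xc X c, x.2.1 = (L.get ⟨t, ht⟩).2.1 →
    (L.get ⟨t, ht⟩).2.2 < x.2.2 → x ∈ L.take t

/-- The sequence `L` is observable under `Ch`: the student of each next contract is
not among the students currently chosen by `Ch`. -/
def ObsSeq (Ch : Finset (C × S × T) → Finset (C × S × T)) (L : List (C × S × T)) : Prop :=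
  ∀ (t : ℕ) (ht : t < L.length), 0 < t →
    (L.get ⟨t, ht⟩).2.1 ∉ (Ch (L.take t).toFinset).image fun y => y.2.1

/-- Observable substitutability for monotone preferences. -/
def ObsSub (c : C) (Ch : Finset (C × S × T) → Finset (C × S × T)) : Prop :=
  ∀ L : List (C × S × T), SeqIn X c L → GenMono X c L → ObsSeq Ch L →
    ∀ t : ℕ, t + 1 ≤ L.length →
      Rej Ch (L.take t).toFinset ⊆ Rej Ch (L.take (t + 1)).toFinset

/-- The observable law of aggregate demand for monotone preferences. -/
def ObsLAD (c : C) (Ch : Finset (C × S × T) → Finset (C × S × T)) : Prop :=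
  ∀ L : List (C × S × T), SeqIn X c L → GenMono X c L → ObsSeq Ch L →
    ∀ t : ℕ, t + 1 ≤ L.length →
      (Ch (L.take t).toFinset).card ≤ (Ch (L.take (t + 1)).toFinset).card

/-- `Y` is an observable set under `Ch`. -/
def ObsSet (c : C) (Ch : Finset (C × S × T) → Finset (C × S × T))
    (Y : Finset (C × S × T)) : Prop :=
  ∃ L : List (C × S × T), L.Nodup ∧ L.toFinset = Y ∧ SeqIn X c L ∧
    GenMono X c L ∧ ObsSeq Ch L

/-- `Ytil` is a maximal observable subset of `Y` under `Ch`. -/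
def MaxObsSubset (c : C) (Ch : Finset (C × S × T) → Finset (C × S × T))
    (Y Ytil : Finset (C × S × T)) : Prop :=
  Ytil ⊆ Y ∧ ObsSet X c Ch Ytil ∧
    ∀ Y', ObsSet X c Ch Y' → Ytil ⊆ Y' → Y' ⊆ Y → Y' = Ytil

/-- `U(Y)`: the contracts in `X_c` that are at least as good for the involved
student as some contract of his in `Y`. -/
def Uset (c : C) (Y : Finset (C × S × T)) : Finset (C × S × T) :=
  (Xc X c).filter fun x => ∃ y ∈ Y, x.2.1 = y.2.1 ∧ (y.2.2 < x.2.2 ∨ x = y)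

/-- `Y^∨`: the (under observable substitutability unique) maximal observable subset
of `U(Y)` under `Ch`. -/
noncomputable def vee (c : C) (Ch : Finset (C × S × T) → Finset (C × S × T))
    (Y : Finset (C × S × T)) : Finset (C × S × T) :=
  if h : ∃ V, MaxObsSubset X c Ch (Uset X c Y) V then h.choose else ∅

/-- The virtual choice function
`Ch'_c(Y) = { x ∈ Y^min : x_S ∈ [Ch_c(Y^∨)]_S }`. -/
noncomputable def virtualChoice (c : C) (Ch : Finset (C × S × T) → Finset (C × S × T))
    (Y : Finset (C × S × T)) : Finset (C × S × T) :=
  (Ymin Y).filter fun x => x.2.1 ∈ (Ch (vee X c Ch Y)).image fun y => y.2.1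

theorem subs_gen {c : C} {Ch : Finset (C × S × T) → Finset (C × S × T)}
    (hs : Substitutes X c Ch) {Z W : Finset (C × S × T)} (hZW : Z ⊆ W) (hW : W ⊆ Xc X c)
    {x : C × S × T} (hx : x ∈ Z) (hxW : x ∈ Ch W) : x ∈ Ch Z := by
  have key : ∀ n : ℕ, ∀ Z W : Finset (C × S × T), Z ⊆ W → W ⊆ Xc X c → x ∈ Z → x ∈ Ch W →
      (W \ Z).card = n → x ∈ Ch Z := by
    intro n
    induction n with
    | zero =>
      intro Z W hZW hW hx hxW hn
      have : W ⊆ Z := by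
        rw [Finset.card_eq_zero] at hn
        exact Finset.sdiff_eq_empty_iff_subset.1 hn
      rwa [Finset.Subset.antisymm hZW this]
    | succ n ih =>
      intro Z W hZW hW hx hxW hn
      have hne : (W \ Z).Nonempty := Finset.card_pos.1 (by omega)
      obtain ⟨z, hz⟩ := hne
      have hz' := Finset.mem_sdiff.1 hz
      have hzx : z ≠ x := fun h => hz'.2 (h ▸ hx)
      have h1 : x ∈ Ch (insert z Z) := by
        refine ih (insert z Z) W (Finset.insert_subset hz'.1 hZW) hW
          (Finset.mem_insert_of_mem hx) hxW ?_
        have : W \ insert z Z = (W \ Z).erase z := by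
          ext a; simp only [Finset.mem_sdiff, Finset.mem_insert, Finset.mem_erase]; tauto
        rw [this, Finset.card_erase_of_mem hz]; omega
      have h2 := hs (Z.erase x) ((Finset.erase_subset _ _).trans (hZW.trans hW)) x
        (hW (hZW hx)) z (hW hz'.1) (Finset.notMem_erase _ _)
        (fun h => hz'.2 (Finset.mem_of_mem_erase h))
      rw [Finset.insert_erase hx] at h2
      exact h2 h1
  exact key _ Z W hZW hW hx hxW rfl

theorem irc_gen {c : C} {Ch : Finset (C × S × T) → Finset (C × S × T)}
    (hc : IsChoice X c Ch) {Z W : Finset (C × S × T)} (hZW : Z ⊆ W) (hW : W ⊆ Xc X c)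
    (hChZ : Ch W ⊆ Z) : Ch Z = Ch W := by
  have key : ∀ n : ℕ, ∀ Z : Finset (C × S × T), Z ⊆ W → Ch W ⊆ Z →
      (W \ Z).card = n → Ch Z = Ch W := by
    intro n
    induction n with
    | zero =>
      intro Z hZW _ hn
      have : W ⊆ Z := by
        rw [Finset.card_eq_zero] at hn
        exact Finset.sdiff_eq_empty_iff_subset.1 hn
      rw [Finset.Subset.antisymm hZW this]
    | succ n ih =>
      intro Z hZW hCZ hn
      have hne : (W \ Z).Nonempty := Finset.card_pos.1 (by omega)
      obtain ⟨z, hz⟩ := hne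
      have hz' := Finset.mem_sdiff.1 hz
      have h1 : Ch (insert z Z) = Ch W := by
        refine ih (insert z Z) (Finset.insert_subset hz'.1 hZW)
          (hCZ.trans (Finset.subset_insert _ _)) ?_
        have : W \ insert z Z = (W \ Z).erase z := by
          ext a; simp only [Finset.mem_sdiff, Finset.mem_insert, Finset.mem_erase]; tauto
        rw [this, Finset.card_erase_of_mem hz]; omega
      rw [← h1]
      exact hc.2.2 Z (hZW.trans hW) z (hW hz'.1) hz'.2 (fun h => hz'.2 (hCZ (h1 ▸ h)))
  exact key _ Z hZW hChZ rfl

section run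

variable {X} {Ch : C → Finset (C × S × T) → Finset (C × S × T)} {u : S → C × S × T → ℤ}

theorem mem_prop {D : Finset (C × S × T)} {x : C × S × T} :
    x ∈ proposals X u D ↔ x ∈ X ∧ x ∉ D ∧ 0 < u x.2.1 x ∧
      ∀ y ∈ X, y ∉ D → y.2.1 = x.2.1 → u x.2.1 y ≤ u x.2.1 x := by
  unfold proposals
  simp only [Finset.mem_filter, Finset.mem_sdiff]
  grind

theorem held_sub (P : Finset (C × S × T)) : held Ch P ⊆ P := Finset.filter_subset _ _

theorem held_filter (hc : ∀ c, IsChoice X c (Ch c)) {P : Finset (C × S × T)} (hP : P ⊆ X) (c : C) :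
    (held Ch P).filter (fun x => x.1 = c) = Ch c (P.filter fun x => x.1 = c) := by
  have h1 := (hc c).1 (P.filter fun x => x.1 = c) (Finset.filter_subset_filter _ hP)
  ext x
  simp only [held, Finset.mem_filter]
  constructor
  · rintro ⟨⟨h, h'⟩, rfl⟩; exact h'
  · intro h
    have := Finset.mem_filter.1 (h1 h)
    obtain ⟨h2, rfl⟩ := this
    exact ⟨⟨h2, h⟩, rfl⟩

theorem prop_alloc (hu : ∀ s, IsPref X s (u s)) (D : Finset (C × S × T)) :
    IsAlloc (proposals X u D) := by
  intro x hx y hy hxy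
  rw [mem_prop] at hx hy
  by_contra hne
  have h1 := hx.2.2.2 y hy.1 hy.2.1 hxy.symm
  have h2 := hy.2.2.2 x hx.1 hx.2.1 hxy
  rw [← hxy] at h2
  exact (hu x.2.1).2.1 x hx.1 y hy.1 rfl hxy.symm hne (le_antisymm h2 h1)

theorem exists_prop {D : Finset (C × S × T)} {x : C × S × T} (hx : x ∈ X) (hxD : x ∉ D)
    (hpos : 0 < u x.2.1 x) :
    ∃ y ∈ proposals X u D, y.2.1 = x.2.1 ∧ u x.2.1 x ≤ u x.2.1 y := by
  obtain ⟨y, hy, hmax⟩ := Finset.exists_max_image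
    (X.filter fun y => y ∉ D ∧ y.2.1 = x.2.1) (u x.2.1) ⟨x, by simp [hx, hxD]⟩
  simp only [Finset.mem_filter] at hy hmax
  have hle := hmax x ⟨hx, hxD, rfl⟩
  refine ⟨y, ?_, hy.2.2, hle⟩
  rw [mem_prop]
  refine ⟨hy.1, hy.2.1, ?_, ?_⟩
  · rw [hy.2.2]; omega
  · intro z hz hzD hzy
    rw [hy.2.2]
    exact hmax z ⟨hz, hzD, hzy.trans hy.2.2⟩

variable (X Ch u) in
/-- rejected set at round `n` -/
def Dn (n : ℕ) : Finset (C × S × T) := (step X Ch u)^[n] ∅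

variable (X Ch u) in
/-- cumulative proposals at round `n` -/
def Wn (n : ℕ) : Finset (C × S × T) := Dn X Ch u n ∪ proposals X u (Dn X Ch u n)

theorem Dn_succ (n : ℕ) : Dn X Ch u (n + 1) = Dn X Ch u n ∪
    (proposals X u (Dn X Ch u n) \ held Ch (proposals X u (Dn X Ch u n))) := by
  simp only [Dn, Function.iterate_succ_apply']; rfl

theorem prop_subX (D : Finset (C × S × T)) : proposals X u D ⊆ X := fun _ h => (mem_prop.1 h).1

theorem Dn_sub (n : ℕ) : Dn X Ch u n ⊆ X := by
  induction n with
  | zero => simp [Dn]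
  | succ n ih =>
    rw [Dn_succ]
    exact Finset.union_subset ih (Finset.sdiff_subset.trans (prop_subX _))

theorem Wn_sub (n : ℕ) : Wn X Ch u n ⊆ X := Finset.union_subset (Dn_sub n) (prop_subX _)

theorem Dn_mono : Monotone (Dn X Ch u) := by
  refine monotone_nat_of_le_succ fun n => ?_
  rw [Dn_succ]; exact Finset.subset_union_left

theorem Dn_fix : Dn X Ch u (X.card + 1 + 1) = Dn X Ch u (X.card + 1) := by
  have key : ∀ n, Dn X Ch u (n + 1) = Dn X Ch u n ∨ n + 1 ≤ (Dn X Ch u (n + 1)).card := by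
    intro n
    induction n with
    | zero =>
      by_cases h : Dn X Ch u (0 + 1) = Dn X Ch u 0
      · exact Or.inl h
      · right
        have : Dn X Ch u 0 ⊂ Dn X Ch u (0 + 1) :=
          (Dn_mono (Nat.le_succ 0)).ssubset_of_ne (Ne.symm h)
        have := Finset.card_lt_card this
        omega
    | succ n ih =>
      by_cases h : Dn X Ch u (n + 1 + 1) = Dn X Ch u (n + 1)
      · exact Or.inl h
      · right
        rcases ih with ih | ih
        · exfalso; apply h
          rw [Dn_succ (n + 1), ih, ← Dn_succ, ih]
        · have : Dn X Ch u (n + 1) ⊂ Dn X Ch u (n + 1 + 1) :=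
            (Dn_mono (Nat.le_succ _)).ssubset_of_ne (Ne.symm h)
          have := Finset.card_lt_card this
          omega
  rcases key (X.card + 1) with h | h
  · exact h
  · have := Finset.card_le_card (Dn_sub (X := X) (Ch := Ch) (u := u) (X.card + 1 + 1))
    omega

theorem DA_eq : DA X Ch u = proposals X u (Dn X Ch u (X.card + 1)) := by
  have h := Dn_fix (X := X) (Ch := Ch) (u := u)
  rw [Dn_succ] at h
  refine Finset.Subset.antisymm (held_sub _) ?_
  intro x hx
  by_contra hne
  have : x ∈ Dn X Ch u (X.card + 1) := by
    rw [← h]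
    exact Finset.mem_union_right _ (Finset.mem_sdiff.2 ⟨hx, hne⟩)
  exact (mem_prop.1 hx).2.1 this

/-- previously rejected contracts are better than the remaining ones -/
theorem Dn_better (n : ℕ) : ∀ x ∈ Dn X Ch u n, 0 < u x.2.1 x ∧
    ∀ y ∈ X, y ∉ Dn X Ch u n → y.2.1 = x.2.1 → u x.2.1 y ≤ u x.2.1 x := by
  induction n with
  | zero => simp [Dn]
  | succ n ih =>
    intro x hx
    have hm : ∀ y, y ∉ Dn X Ch u (n + 1) → y ∉ Dn X Ch u n :=
      fun y hy h => hy (Dn_mono (Nat.le_succ n) h)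
    rw [Dn_succ, Finset.mem_union] at hx
    rcases hx with hx | hx
    · exact ⟨(ih x hx).1, fun y hy hyD => (ih x hx).2 y hy (hm y hyD)⟩
    · have := mem_prop.1 (Finset.mem_sdiff.1 hx).1
      exact ⟨this.2.2.1, fun y hy hyD => this.2.2.2 y hy (hm y hyD)⟩

theorem Wn_better (n : ℕ) : ∀ x ∈ Wn X Ch u n, 0 < u x.2.1 x ∧
    ∀ y ∈ X, y ∉ Dn X Ch u n → y.2.1 = x.2.1 → u x.2.1 y ≤ u x.2.1 x := by
  intro x hx
  rcases Finset.mem_union.1 hx with hx | hx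
  · exact Dn_better n x hx
  · exact (mem_prop.1 hx).2.2

theorem Wn_choice (hc : ∀ c, IsChoice X c (Ch c)) (hs : ∀ c, Substitutes X c (Ch c)) (n : ℕ) :
    ∀ c, Ch c ((Wn X Ch u n).filter fun x => x.1 = c) =
      (held Ch (proposals X u (Dn X Ch u n))).filter (fun x => x.1 = c) := by
  have hX : ∀ n c, ((Wn X Ch u n).filter fun x => x.1 = c) ⊆ Xc X c :=
    fun n c => Finset.filter_subset_filter _ (Wn_sub n)
  -- enough: nothing in D is chosen
  have red : ∀ n, (∀ c, ∀ x ∈ Dn X Ch u n, x ∉ Ch c ((Wn X Ch u n).filter fun x => x.1 = c)) →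
      ∀ c, Ch c ((Wn X Ch u n).filter fun x => x.1 = c) =
      (held Ch (proposals X u (Dn X Ch u n))).filter (fun x => x.1 = c) := by
    intro n h c
    rw [held_filter hc (prop_subX _)]
    symm
    refine irc_gen X (hc c) ?_ (hX n c) ?_
    · exact Finset.filter_subset_filter _ Finset.subset_union_right
    · intro x hx
      have h1 := Finset.mem_filter.1 ((hc c).1 _ (hX n c) hx)
      rcases Finset.mem_union.1 h1.1 with h2 | h2
      · exact absurd hx (h c x h2)
      · exact Finset.mem_filter.2 ⟨h2, h1.2⟩
  induction n with
  | zero => exact red 0 (by simp [Dn])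
  | succ n ih =>
    refine red (n + 1) ?_
    have hWW : Wn X Ch u n ⊆ Wn X Ch u (n + 1) := by
      intro x hx
      by_cases hD : x ∈ Dn X Ch u (n + 1)
      · exact Finset.mem_union_left _ hD
      · refine Finset.mem_union_right _ (mem_prop.2 ⟨Wn_sub n hx, hD, (Wn_better n x hx).1, ?_⟩)
        intro y hy hyD
        exact (Wn_better n x hx).2 y hy (fun h => hyD (Dn_mono (Nat.le_succ n) h))
    intro c x hx hxc
    have hxW : x ∈ Wn X Ch u n := by
      rw [Dn_succ] at hx
      rcases Finset.mem_union.1 hx with h | h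
      · exact Finset.mem_union_left _ h
      · exact Finset.mem_union_right _ (Finset.mem_sdiff.1 h).1
    have hcx := (Finset.mem_filter.1 ((hc c).1 _ (hX (n + 1) c) hxc)).2
    have h1 := subs_gen X (hs c) (Finset.filter_subset_filter (fun x => x.1 = c) hWW) (hX (n + 1) c)
      (Finset.mem_filter.2 ⟨hxW, hcx⟩) hxc
    rw [ih c] at h1
    have h2 := (Finset.mem_filter.1 h1).1
    rw [Dn_succ] at hx
    rcases Finset.mem_union.1 hx with h | h
    · exact (mem_prop.1 (held_sub _ h2)).2.1 h
    · exact (Finset.mem_sdiff.1 h).2 h2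

theorem util_mem {us : C × S × T → ℤ} {Y : Finset (C × S × T)} (hY : IsAlloc Y)
    {y : C × S × T} (hy : y ∈ Y) : util us y.2.1 Y = us y := by
  unfold util
  have : Y.filter (fun x => x.2.1 = y.2.1) = {y} := by
    ext x
    simp only [Finset.mem_filter, Finset.mem_singleton]
    constructor
    · rintro ⟨h, h'⟩; exact hY x h y hy h'
    · rintro rfl; exact ⟨hy, rfl⟩
  rw [this, Finset.sum_singleton]

theorem util_none {us : C × S × T → ℤ} {Y : Finset (C × S × T)} {s : S}
    (h : ∀ y ∈ Y, y.2.1 ≠ s) : util us s Y = 0 := by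
  unfold util
  rw [Finset.filter_eq_empty_iff.2 (fun y hy => h y hy), Finset.sum_empty]

theorem DA_alloc (hu : ∀ s, IsPref X s (u s)) : IsAlloc (DA X Ch u) := by
  rw [DA_eq]; exact prop_alloc hu _

theorem Wn_util (hu : ∀ s, IsPref X s (u s)) {n : ℕ} (hn : n ≤ X.card + 1) {x : C × S × T}
    (hx : x ∈ Wn X Ch u n) : util (u x.2.1) x.2.1 (DA X Ch u) ≤ u x.2.1 x := by
  have hb := Wn_better n x hx
  by_cases h : ∃ y ∈ DA X Ch u, y.2.1 = x.2.1
  · obtain ⟨y, hy, hyx⟩ := h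
    have h1 := util_mem (us := u x.2.1) (DA_alloc hu) hy
    rw [hyx] at h1
    rw [h1]
    rw [DA_eq] at hy
    have := mem_prop.1 hy
    exact hb.2 y this.1 (fun h => this.2.1 (Dn_mono hn h)) hyx
  · push Not at h
    rw [util_none h]
    exact hb.1.le

/-- contracts at least as good as the outcome have been proposed -/
theorem mem_W_of_util (hu : ∀ s, IsPref X s (u s)) {x : C × S × T} (hx : x ∈ X)
    (hpos : 0 < u x.2.1 x) (hle : util (u x.2.1) x.2.1 (DA X Ch u) ≤ u x.2.1 x) :
    x ∈ Wn X Ch u (X.card + 1) := by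
  by_cases hD : x ∈ Dn X Ch u (X.card + 1)
  · exact Finset.mem_union_left _ hD
  · obtain ⟨y, hy, hyx, hxy⟩ := exists_prop hx hD hpos
    have hyA : y ∈ DA X Ch u := by rw [DA_eq]; exact hy
    have h1 := util_mem (us := u x.2.1) (DA_alloc hu) hyA
    rw [hyx] at h1
    have : x = y := by
      by_contra hne
      exact (hu x.2.1).2.1 x hx y (prop_subX _ hy) rfl hyx hne (by omega)
    rw [this]
    exact Finset.mem_union_right _ hy

theorem mem_D_of_util (hu : ∀ s, IsPref X s (u s)) {x : C × S × T} (hx : x ∈ X)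
    (hpos : 0 < u x.2.1 x) (hlt : util (u x.2.1) x.2.1 (DA X Ch u) < u x.2.1 x) :
    x ∈ Dn X Ch u (X.card + 1) := by
  rcases Finset.mem_union.1 (mem_W_of_util hu hx hpos hlt.le) with h | h
  · exact h
  · rw [util_mem (DA_alloc hu) (by rw [DA_eq]; exact h)] at hlt
    omega

theorem util_nonneg (hu : ∀ s, IsPref X s (u s)) (s : S) : 0 ≤ util (u s) s (DA X Ch u) := by
  by_cases h : ∃ y ∈ DA X Ch u, y.2.1 = s
  · obtain ⟨y, hy, rfl⟩ := h
    rw [util_mem (DA_alloc hu) hy]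
    rw [DA_eq] at hy
    exact (mem_prop.1 hy).2.2.1.le
  · push Not at h
    rw [util_none h]

theorem gsp_aux (hc : ∀ c, IsChoice X c (Ch c)) (hs : ∀ c, Substitutes X c (Ch c))
    (hl : ∀ c, LAD X c (Ch c)) : GSP X (DA X Ch) := by
  intro u u' hu hu' S' hne hout
  by_contra hcon
  push Not at hcon
  obtain ⟨Y, hYdef⟩ : ∃ Y, Y = DA X Ch u' := ⟨_, rfl⟩
  have hYalloc : IsAlloc Y := hYdef ▸ DA_alloc hu'
  have hYX : Y ⊆ X := by rw [hYdef, DA_eq]; exact prop_subX _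
  rw [← hYdef] at hcon
  let G : S → Prop := fun s => util (u s) s (DA X Ch u) < util (u s) s Y
  have hGS : ∀ s, ¬ G s → u' s = u s := fun s hs => hout s (fun h => hs (hcon s h))
  -- gainers are matched
  have hGm : ∀ s, G s → ∃ y ∈ Y, y.2.1 = s := by
    intro s hs
    by_contra h
    push Not at h
    have h1 : util (u s) s (DA X Ch u) < util (u s) s Y := hs
    rw [util_none h] at h1
    have := util_nonneg (Ch := Ch) hu s
    omega
  have hGD : ∀ y ∈ Y, G y.2.1 → y ∈ Dn X Ch u (X.card + 1) := by
    intro y hy hs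
    have h1 : util (u y.2.1) y.2.1 (DA X Ch u) < util (u y.2.1) y.2.1 Y := hs
    rw [util_mem hYalloc hy] at h1
    have := util_nonneg (Ch := Ch) hu y.2.1
    exact mem_D_of_util hu (hYX hy) (by omega) h1
  -- critical round
  have hex : ∃ n, ∀ y ∈ Y, G y.2.1 → y ∈ Dn X Ch u n := ⟨_, hGD⟩
  obtain ⟨r, hr1, hr0, hrle⟩ : ∃ r, (∀ y ∈ Y, G y.2.1 → y ∈ Dn X Ch u (r + 1)) ∧
      (¬ ∀ y ∈ Y, G y.2.1 → y ∈ Dn X Ch u r) ∧ r ≤ X.card + 1 := by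
    have hsp := Nat.find_spec hex
    have hle : Nat.find hex ≤ X.card + 1 := Nat.find_min' hex hGD
    obtain ⟨s0, hs0⟩ := hne
    obtain ⟨y0, hy0, hys⟩ := hGm s0 (hcon s0 hs0)
    cases hf : Nat.find hex with
    | zero =>
      rw [hf] at hsp
      have := hsp y0 hy0 (by rw [hys]; exact hcon s0 hs0)
      simp [Dn] at this
    | succ r =>
      rw [hf] at hsp
      exact ⟨r, hsp, Nat.find_min hex (by omega), by omega⟩
  push Not at hr0
  obtain ⟨y, hyY, hyG, hyr⟩ := hr0
  let P := proposals X u (Dn X Ch u r)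
  let H := held Ch P
  have hyP : y ∈ P ∧ y ∉ H := by
    have := hr1 y hyY hyG
    rw [Dn_succ] at this
    rcases Finset.mem_union.1 this with h | h
    · exact absurd h hyr
    · exact Finset.mem_sdiff.1 h
  have hHP : H ⊆ P := held_sub _
  have hPa : IsAlloc P := prop_alloc hu _
  let W := Wn X Ch u r
  let W' := Wn X Ch u' (X.card + 1)
  let I := W.filter fun x => ¬ G x.2.1 ∨ x ∈ Y
  have hYW' : Y ⊆ W' := by
    rw [hYdef, DA_eq]; exact Finset.subset_union_right
  have hIW : I ⊆ W := Finset.filter_subset _ _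
  have hIW' : I ⊆ W' := by
    intro x hx
    obtain ⟨hxW, hx⟩ := Finset.mem_filter.1 hx
    rcases hx with hx | hx
    · have h0 := (Wn_better r x hxW).1
      have h1 := Wn_util hu hrle hxW
      have h2 : ¬ (util (u x.2.1) x.2.1 (DA X Ch u) < util (u x.2.1) x.2.1 Y) := hx
      have h3 := hGS _ hx
      refine mem_W_of_util hu' (Wn_sub r hxW) (by rw [h3]; exact h0) ?_
      rw [h3, ← hYdef]; omega
    · exact hYW' hx
  have hWX : ∀ c, W.filter (fun x => x.1 = c) ⊆ Xc X c :=
    fun c => Finset.filter_subset_filter _ (Wn_sub _)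
  have hWX' : ∀ c, W'.filter (fun x => x.1 = c) ⊆ Xc X c :=
    fun c => Finset.filter_subset_filter _ (Wn_sub _)
  let Y1 := Y.filter fun x => G x.2.1
  let H1 := H.filter fun x => G x.2.1
  have hY1I : Y1 ⊆ I := by
    intro x hx
    obtain ⟨hxY, hxG⟩ := Finset.mem_filter.1 hx
    refine Finset.mem_filter.2 ⟨?_, Or.inr hxY⟩
    have := hr1 x hxY hxG
    rw [Dn_succ] at this
    rcases Finset.mem_union.1 this with h | h
    · exact Finset.mem_union_left _ h
    · exact Finset.mem_union_right _ (Finset.mem_sdiff.1 h).1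
  have hcW : ∀ c, Ch c (W.filter fun x => x.1 = c) = H.filter (fun x => x.1 = c) :=
    fun c => Wn_choice hc hs r c
  have hcW' : ∀ c, Ch c (W'.filter fun x => x.1 = c) = Y.filter (fun x => x.1 = c) := by
    intro c
    rw [hYdef]
    exact Wn_choice hc hs _ c
  have hcard : ∀ c, (Y1.filter fun x => x.1 = c).card ≤ (H1.filter fun x => x.1 = c).card := by
    intro c
    let H2 := H.filter fun x => ¬ G x.2.1
    have hsubI : (Y1.filter fun x => x.1 = c) ∪ (H2.filter fun x => x.1 = c) ⊆
        Ch c (I.filter fun x => x.1 = c) := by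
      intro x hx
      rcases Finset.mem_union.1 hx with hx | hx
      · obtain ⟨hx1, hxc⟩ := Finset.mem_filter.1 hx
        refine subs_gen X (hs c) (Finset.filter_subset_filter _ hIW') (hWX' c)
          (Finset.mem_filter.2 ⟨hY1I hx1, hxc⟩) ?_
        rw [hcW']
        exact Finset.mem_filter.2 ⟨(Finset.mem_filter.1 hx1).1, hxc⟩
      · obtain ⟨hx1, hxc⟩ := Finset.mem_filter.1 hx
        obtain ⟨hxH, hxG⟩ := Finset.mem_filter.1 hx1
        refine subs_gen X (hs c) (Finset.filter_subset_filter _ hIW) (hWX c)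
          (Finset.mem_filter.2 ⟨Finset.mem_filter.2
            ⟨Finset.mem_union_right _ (hHP hxH), Or.inl hxG⟩, hxc⟩) ?_
        rw [hcW]
        exact Finset.mem_filter.2 ⟨hxH, hxc⟩
    have h1 := Finset.card_le_card hsubI
    have h2 := hl c _ _ (Finset.filter_subset_filter (fun x => x.1 = c) hIW) (hWX c)
    rw [hcW] at h2
    rw [Finset.card_union_of_disjoint] at h1
    · have h3 : (H.filter fun x => x.1 = c) =
          (H1.filter fun x => x.1 = c) ∪ (H2.filter fun x => x.1 = c) := by
        ext x
        simp only [H1, H2, Finset.mem_union, Finset.mem_filter]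
        tauto
      have h4 := Finset.card_union_le (H1.filter fun x => x.1 = c) (H2.filter fun x => x.1 = c)
      rw [← h3] at h4
      omega
    · rw [Finset.disjoint_left]
      intro x hx hx'
      exact (Finset.mem_filter.1 (Finset.mem_filter.1 hx').1).2
        (Finset.mem_filter.1 (Finset.mem_filter.1 hx).1).2
  have htot : Y1.card ≤ H1.card := by
    have e1 := Finset.card_eq_sum_card_fiberwise (f := fun x : C × S × T => x.1) (s := Y1)
      (t := (Y1 ∪ H1).image fun x => x.1)
      (fun x hx => Finset.mem_image_of_mem _ (Finset.mem_union_left _ hx))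
    have e2 := Finset.card_eq_sum_card_fiberwise (f := fun x : C × S × T => x.1) (s := H1)
      (t := (Y1 ∪ H1).image fun x => x.1)
      (fun x hx => Finset.mem_image_of_mem _ (Finset.mem_union_right _ hx))
    rw [e1, e2]
    exact Finset.sum_le_sum fun c _ => hcard c
  have hlt : H1.card < Y1.card := by
    have i1 : (H1.image fun x => x.2.1).card = H1.card := by
      refine Finset.card_image_of_injOn ?_
      intro a ha b hb hab
      exact hPa a (hHP (Finset.mem_filter.1 ha).1) b (hHP (Finset.mem_filter.1 hb).1) hab
    have i2 : (Y1.image fun x => x.2.1).card = Y1.card := by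
      refine Finset.card_image_of_injOn ?_
      intro a ha b hb hab
      exact hYalloc a (Finset.mem_filter.1 ha).1 b (Finset.mem_filter.1 hb).1 hab
    rw [← i1, ← i2]
    refine Finset.card_lt_card (Finset.ssubset_iff_subset_ne.2 ⟨?_, ?_⟩)
    · intro s hs
      obtain ⟨x, hx, rfl⟩ := Finset.mem_image.1 hs
      have hxG := (Finset.mem_filter.1 hx).2
      obtain ⟨z, hz, hzs⟩ := hGm _ hxG
      exact Finset.mem_image.2 ⟨z, Finset.mem_filter.2 ⟨hz, by rw [hzs]; exact hxG⟩, hzs⟩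
    · intro h
      have : y.2.1 ∈ H1.image fun x => x.2.1 := by
        rw [h]
        exact Finset.mem_image.2 ⟨y, Finset.mem_filter.2 ⟨hyY, hyG⟩, rfl⟩
      obtain ⟨x, hx, hxy⟩ := Finset.mem_image.1 this
      have hxH := (Finset.mem_filter.1 hx).1
      have := hPa x (hHP hxH) y hyP.1 hxy
      exact hyP.2 (this ▸ hxH)
  omega

end run

/-- if `Ch` is DA-equivalent to a profile under which contracts are
substitutes and the law of aggregate demand holds, then the deferred acceptance
mechanism for `Ch` is group-strategy-proof. -/
theorem statement_3 [Fintype C] [Fintype S] [Fintype T]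
    (X : Finset (C × S × T)) (Ch Ch' : C → Finset (C × S × T) → Finset (C × S × T))
    (hCh : ∀ c, IsChoice X c (Ch c))
    (hCh' : ∀ c, IsChoice X c (Ch' c))
    (heq : DAeq X Ch Ch')
    (hsub' : ∀ c, Substitutes X c (Ch' c))
    (hlad' : ∀ c, LAD X c (Ch' c)) :
    GSP X (DA X Ch) := by
  intro u u' hu hu' S' hne hout
  rw [heq u hu, heq u' hu']
  exact gsp_aux hCh' hsub' hlad' u u' hu hu' S' hne hout
end MWC
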